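/- arXiv:1307.2292 — 6 statements merged into one kernel-verified Lean document; each statement's English description precedes it below -/
import Mathlib

section
/- Let n ≥ 1 and let P, v₀, v₁, …, v_{n-1} ∈ ℝⁿ satisfy ⟨P, v₀⟩ = 1 and ⟨P, v_j⟩ = 0 for j = 1, …, n-1. Then |det(v₀ v₁ ⋯ v_{n-1})| = √(det G) / ‖P‖, where det(v₀ v₁ ⋯ v_{n-1}) is the determinant of the n×n matrix with columns v₀, …, v_{n-1}, G is the (n-1)×(n-1) Gram matrix G_{jk} = ⟨v_j, v_k⟩ (j,k = 1, …, n-1), and ‖P‖ is the Euclidean norm (note ‖P‖ ≠ 0 since ⟨P, v₀⟩ = 1). -/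
open scoped RealInnerProductSpace

/-- The square of the determinant of a family of vectors in `ℝⁿ` is its Gram determinant. -/
theorem det_sq_eq_det_gram {n : ℕ} (w : Fin n → EuclideanSpace ℝ (Fin n)) :
    (Matrix.of fun i j => w j i).det ^ 2 = (Matrix.of fun j k => ⟪w j, w k⟫).det := by
  have h : (Matrix.of fun j k => ⟪w j, w k⟫) =
      (Matrix.of fun i j => w j i).transpose * Matrix.of fun i j => w j i := by
    ext j k
    simp [Matrix.mul_apply, PiLp.inner_apply, mul_comm]
  rw [h, Matrix.det_mul, Matrix.det_transpose, sq]

/-- If the first vector of a family is orthogonal to the others, the Gram determinant of the family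
splits off its squared norm. -/
theorem det_gram_cons {E : Type*} [NormedAddCommGroup E] [InnerProductSpace ℝ E] {n : ℕ}
    (P : E) (u : Fin n → E) (hu : ∀ j, ⟪P, u j⟫ = 0) :
    (Matrix.of fun j k : Fin (n + 1) =>
      ⟪(Fin.cons P u : Fin (n + 1) → E) j, (Fin.cons P u : Fin (n + 1) → E) k⟫).det =
      ‖P‖ ^ 2 * (Matrix.of fun j k => ⟪u j, u k⟫).det := by
  rw [Matrix.det_succ_row_zero, Fin.sum_univ_succ]
  simp only [Matrix.of_apply, Fin.cons_zero, Fin.cons_succ, hu, mul_zero, zero_mul,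
    Finset.sum_const_zero, add_zero, Fin.val_zero, pow_zero, one_mul, real_inner_self_eq_norm_sq]
  congr 2

/-- Vectors all orthogonal to a common nonzero vector have zero determinant. -/
theorem det_eq_zero_of_inner_eq_zero {n : ℕ} {P : EuclideanSpace ℝ (Fin n)} (hP : P ≠ 0)
    (w : Fin n → EuclideanSpace ℝ (Fin n)) (hw : ∀ j, ⟪P, w j⟫ = 0) :
    (Matrix.of fun i j => w j i).det = 0 := by
  refine Matrix.exists_vecMul_eq_zero_iff.mp ⟨P.ofLp, by simpa using hP, ?_⟩
  ext j
  simpa [Matrix.vecMul, dotProduct, PiLp.inner_apply, mul_comm] using hw j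

/-- If `⟪P, v 0⟫ = 1` and `P` is orthogonal to the other `v j`, replacing `v 0` by `P` multiplies
the determinant by `‖P‖ ^ 2`. -/
theorem det_cons_eq_norm_sq_mul_det {n : ℕ} {P : EuclideanSpace ℝ (Fin (n + 1))}
    {v : Fin (n + 1) → EuclideanSpace ℝ (Fin (n + 1))}
    (h0 : ⟪P, v 0⟫ = 1) (hj : ∀ j : Fin n, ⟪P, v j.succ⟫ = 0) :
    (Matrix.of fun i j => (Fin.cons P (fun k : Fin n => v k.succ) :
      Fin (n + 1) → EuclideanSpace ℝ (Fin (n + 1))) j i).det =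
      ‖P‖ ^ 2 * (Matrix.of fun i j => v j i).det := by
  have hP : P ≠ 0 := by rintro rfl; simp at h0
  have hz := det_eq_zero_of_inner_eq_zero hP
    (Fin.cons (P - ‖P‖ ^ 2 • v 0) fun k : Fin n => v k.succ) (by
      intro j
      refine Fin.cases ?_ (fun k => ?_) j
      · simp [inner_sub_right, inner_smul_right, h0]
      · simpa using hj k)
  have hupdate (x : EuclideanSpace ℝ (Fin (n + 1))) :
      (Matrix.of fun i j => (Fin.cons x (fun k : Fin n => v k.succ) :
        Fin (n + 1) → EuclideanSpace ℝ (Fin (n + 1))) j i) =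
        (Matrix.of fun i j => v j i).updateCol 0 x.ofLp := by
    ext i j
    refine Fin.cases ?_ (fun k => ?_) j <;> simp
  have hself : (Matrix.of fun i j => v j i).updateCol 0 (v 0).ofLp = Matrix.of fun i j => v j i :=
    Matrix.updateCol_eq_self _ 0
  have hsplit : P.ofLp = (P - ‖P‖ ^ 2 • v 0).ofLp + ‖P‖ ^ 2 • (v 0).ofLp := by
    simp
  rw [hupdate] at hz ⊢
  rw [hsplit, Matrix.det_updateCol_add, Matrix.det_updateCol_smul, hz, zero_add, hself]

/-- Pointwise linear-algebra content of `|𝒥| = √(det(X_ψ* X_ψ))/(|μ| ‖P‖)`: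
if `P, v₀, …, v_n ∈ ℝ^{n+1}` satisfy `⟨P, v₀⟩ = 1` and `⟨P, v_j⟩ = 0` for
`j ≥ 1`, then `|det(v₀ v₁ ⋯ v_n)| = √(det G)/‖P‖`, where `G` is the Gram
matrix of `v₁, …, v_n`. -/
theorem stmt1 (n : ℕ) (P : EuclideanSpace ℝ (Fin (n + 1)))
    (v : Fin (n + 1) → EuclideanSpace ℝ (Fin (n + 1)))
    (h0 : ⟪P, v 0⟫ = 1) (hj : ∀ j : Fin n, ⟪P, v j.succ⟫ = 0) :
    |Matrix.det (Matrix.of fun i j : Fin (n + 1) => v j i)| =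
      Real.sqrt (Matrix.det (Matrix.of fun j k : Fin n => ⟪v j.succ, v k.succ⟫)) / ‖P‖ := by
  have hP : P ≠ 0 := by rintro rfl; simp at h0
  have hnorm : 0 < ‖P‖ := norm_pos_iff.mpr hP
  have hsq := det_sq_eq_det_gram (Fin.cons P fun k : Fin n => v k.succ)
  rw [det_gram_cons P _ hj, det_cons_eq_norm_sq_mul_det h0 hj] at hsq
  have hgram : (Matrix.of fun j k : Fin n => ⟪v j.succ, v k.succ⟫).det =
      (Matrix.det (Matrix.of fun i j : Fin (n + 1) => v j i) * ‖P‖) ^ 2 := by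
    refine mul_left_cancel₀ (pow_ne_zero 2 hnorm.ne') ?_
    rw [← hsq]
    ring
  rw [hgram, Real.sqrt_sq_eq_abs, abs_mul, abs_of_pos hnorm, mul_div_cancel_right₀ _ hnorm.ne']
end

section
/- Let n ≥ 2, let U ⊆ ℝ × ℝ^{n-1} be open with coordinates (τ, ψ), and let X, P : U → ℝⁿ be smooth maps satisfying ⟨P, ∂X/∂τ⟩ = 1 and ⟨P, ∂X/∂ψ_j⟩ = 0 (j = 1, …, n-1) on U, and such that the 2n×n Jacobian matrix of the combined map (X, P) : U → ℝ^{2n} has rank n at every point. Fix (τ*, ψ*) ∈ U, let k = rank(∂X/∂ψ)(τ*, ψ*), write ψ = (ψ', ψ'') with ψ' = (ψ₁, …, ψ_k), ψ'' = (ψ_{k+1}, …, ψ_{n-1}), and assume the columns ∂X/∂ψ₁, …, ∂X/∂ψ_k are linearly independent at (τ*, ψ*). Set x* = X(τ*, ψ*). Then there exist an open neighborhood W of (x*, ψ''*) in ℝⁿ × ℝ^{n-1-k} and smooth functions T : W → ℝ and Ψ' : W → ℝ^k with T(x*, ψ''*) = τ*, Ψ'(x*, ψ''*) = ψ'*, (T(x,ψ''),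 Ψ'(x,ψ''), ψ'') ∈ U, and such that for all (x, ψ'') ∈ W: ⟨P(T, Ψ', ψ''), x − X(T, Ψ', ψ'')⟩ = 0 and ⟨∂X/∂ψ_j(T, Ψ', ψ''), x − X(T, Ψ', ψ'')⟩ = 0 for j = 1, …, k, where T = T(x, ψ'') and Ψ' = Ψ'(x, ψ''). -/
open scoped RealInnerProductSpace

open Filter Topology

/-- Implicit function theorem for smooth maps: the implicit function is smooth on a whole open
neighbourhood of the base point. -/
theorem exists_contDiffOn_implicitFunction {E F G : Type*}
    [NormedAddCommGroup E] [NormedSpace ℝ E] [CompleteSpace E]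
    [NormedAddCommGroup F] [NormedSpace ℝ F] [CompleteSpace F]
    [NormedAddCommGroup G] [NormedSpace ℝ G] [CompleteSpace G]
    {f : E × F → G} {S : Set (E × F)} (hS : IsOpen S) (hf : ContDiffOn ℝ (⊤ : ℕ∞) f S)
    {u : E × F} (hu : u ∈ S) (hinv : (fderiv ℝ f u ∘L .inr ℝ E F).IsInvertible) :
    ∃ W : Set E, IsOpen W ∧ u.1 ∈ W ∧ ∃ g : E → F, ContDiffOn ℝ (⊤ : ℕ∞) g W ∧ g u.1 = u.2 ∧
      ∀ w ∈ W, (w, g w) ∈ S ∧ f (w, g w) = f u := by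
  have h0 : ((⊤ : ℕ∞) : WithTop ℕ∞) ≠ 0 := by simp
  have hfat : ∀ v ∈ S, ContDiffAt ℝ (⊤ : ℕ∞) f v := fun v hv => hf.contDiffAt (hS.mem_nhds hv)
  set g := (hfat u hu).implicitFunction h0 hinv
  have hgu : g u.1 = u.2 := (hfat u hu).implicitFunction_apply_self h0 hinv
  have hdc : ContinuousAt (fun v => fderiv ℝ f v ∘L .inr ℝ E F) u := by
    have : ContinuousAt (fderiv ℝ f) u :=
      (hf.continuousOn_fderiv_of_isOpen hS (by exact_mod_cast le_top)).continuousAt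
        (hS.mem_nhds hu)
    exact this.clm_comp continuousAt_const
  have hinv' : ∀ᶠ v in 𝓝 u, (fderiv ℝ f v ∘L .inr ℝ E F).IsInvertible := by
    obtain ⟨e, he⟩ := hinv
    have := e.nhds
    rw [he] at this
    exact hdc.eventually this
  have hgc : Tendsto (fun w => (w, g w)) (𝓝 u.1) (𝓝 u) := by
    have hc : ContinuousAt g u.1 :=
      ((hfat u hu).contDiffAt_implicitFunction h0 hinv).continuousAt
    have := continuousAt_id.prodMk hc
    simpa [ContinuousAt, hgu] using this
  have hev := hgc.eventually ((hS.eventually_mem hu).and (hinv'.and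
    (eventually_eventually_nhds.2
      ((hfat u hu).eventually_apply_eq_iff_implicitFunction h0 hinv))))
  obtain ⟨W, hW, hWo, huW⟩ := eventually_nhds_iff.1
    (hev.and ((hfat u hu).eventually_apply_implicitFunction h0 hinv))
  refine ⟨W, hWo, huW, g, fun w hw => ?_, hgu, fun w hw => ⟨(hW w hw).1.1, (hW w hw).2⟩⟩
  obtain ⟨⟨hwS, hwinv, hwiff⟩, hwf⟩ := hW w hw
  have hcd := (hfat _ hwS).contDiffAt_implicitFunction h0 hwinv
  refine (hcd.congr_of_eventuallyEq ?_).contDiffWithinAt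
  have hself := (hfat _ hwS).implicitFunction_apply_self h0 hwinv
  have ht : Tendsto (fun w' => (w', (hfat _ hwS).implicitFunction h0 hwinv w')) (𝓝 w)
      (𝓝 (w, g w)) := by
    have := continuousAt_id.prodMk hcd.continuousAt
    simpa [ContinuousAt, hself] using this
  filter_upwards [ht.eventually hwiff,
    (hfat _ hwS).eventually_apply_implicitFunction h0 hwinv] with w' h1 h2
  exact h1.1 (h2.trans hwf)

/-- At a zero of `B`, only the derivative of `B` contributes to that of `⟪A, B⟫`. -/
theorem fderiv_inner_apply_of_eq_zero {E H : Type*}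
    [NormedAddCommGroup E] [NormedSpace ℝ E] [NormedAddCommGroup H] [InnerProductSpace ℝ H]
    {A B : E → H} {u : E} (hA : DifferentiableAt ℝ A u) (hB : DifferentiableAt ℝ B u)
    (h : B u = 0) (v : E) :
    fderiv ℝ (fun q => ⟪A q, B q⟫) u v = ⟪A u, fderiv ℝ B u v⟫ := by
  rw [fderiv_inner_apply ℝ hA hB, h, inner_zero_right, add_zero]

/-- An injective continuous endomorphism of a finite-dimensional space is invertible. -/
theorem ContinuousLinearMap.isInvertible_of_injective {F : Type*}
    [NormedAddCommGroup F] [NormedSpace ℝ F] [FiniteDimensional ℝ F] {L : F →L[ℝ] F}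
    (hL : ∀ v, L v = 0 → v = 0) : L.IsInvertible :=
  ⟨(LinearEquiv.ofInjectiveEndo L.toLinearMap
    ((injective_iff_map_eq_zero L.toLinearMap).2 hL)).toContinuousLinearEquiv, by ext; rfl⟩

/-- Existence of the implicit functions `τ = τ(x, ψ'')`, `ψ' = ψ'(x, ψ'')`
defining the new singular chart of the canonical operator near a focal point.
Here the Lagrangian manifold (`n = k + l + 1 ≥ 2`) is parametrized in eikonal
coordinates `(τ, ψ', ψ'') ∈ U ⊆ ℝ × ℝᵏ × ℝˡ` by smooth immersions `X, P`
satisfying `⟨P, X_τ⟩ = 1`, `⟨P, X_{ψ_j}⟩ = 0` (combined Jacobian of `(X, P)`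
of rank `n`), with `rank X_ψ = k` at the base point `(τ*, ψ'*, ψ''*)` and
`X_{ψ'_1}, …, X_{ψ'_k}` linearly independent there. The functions `T, Ψ'`
solve `⟨P, x − X⟩ = 0`, `⟨X_{ψ'_j}, x − X⟩ = 0` near `(x*, ψ''*)`. -/
theorem stmt2 (k l : ℕ) (hkl : 1 ≤ k + l)
    (U : Set (ℝ × (Fin k → ℝ) × (Fin l → ℝ))) (hU : IsOpen U)
    (X P : ℝ × (Fin k → ℝ) × (Fin l → ℝ) → EuclideanSpace ℝ (Fin (k + l + 1)))
    (hX : ContDiffOn ℝ (⊤ : ℕ∞) X U) (hP : ContDiffOn ℝ (⊤ : ℕ∞) P U)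
    (heik1 : ∀ u ∈ U, ⟪P u, fderiv ℝ X u (1, 0, 0)⟫ = 1)
    (heik2 : ∀ u ∈ U, ∀ j : Fin k, ⟪P u, fderiv ℝ X u (0, Pi.single j 1, 0)⟫ = 0)
    (heik3 : ∀ u ∈ U, ∀ j : Fin l, ⟪P u, fderiv ℝ X u (0, 0, Pi.single j 1)⟫ = 0)
    (himm : ∀ u ∈ U,
      Module.finrank ℝ
        ↥(LinearMap.range (fderiv ℝ (fun w => (X w, P w)) u).toLinearMap) = k + l + 1)
    (τs : ℝ) (ψ's : Fin k → ℝ) (ψ''s : Fin l → ℝ) (hbase : (τs, ψ's, ψ''s) ∈ U)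
    (hrankψ : Module.finrank ℝ
      ↥(Submodule.span ℝ (Set.range fun v : (Fin k → ℝ) × (Fin l → ℝ) =>
        fderiv ℝ X (τs, ψ's, ψ''s) (0, v.1, v.2))) = k)
    (hindep : LinearIndependent ℝ
      (fun j : Fin k => fderiv ℝ X (τs, ψ's, ψ''s) (0, Pi.single j 1, 0))) :
    ∃ W : Set (EuclideanSpace ℝ (Fin (k + l + 1)) × (Fin l → ℝ)),
      IsOpen W ∧ (X (τs, ψ's, ψ''s), ψ''s) ∈ W ∧
      ∃ T : EuclideanSpace ℝ (Fin (k + l + 1)) × (Fin l → ℝ) → ℝ,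
      ∃ Ψ' : EuclideanSpace ℝ (Fin (k + l + 1)) × (Fin l → ℝ) → (Fin k → ℝ),
        ContDiffOn ℝ (⊤ : ℕ∞) T W ∧ ContDiffOn ℝ (⊤ : ℕ∞) Ψ' W ∧
        T (X (τs, ψ's, ψ''s), ψ''s) = τs ∧ Ψ' (X (τs, ψ's, ψ''s), ψ''s) = ψ's ∧
        ∀ w ∈ W,
          (T w, Ψ' w, w.2) ∈ U ∧
          ⟪P (T w, Ψ' w, w.2), w.1 - X (T w, Ψ' w, w.2)⟫ = 0 ∧
          ∀ j : Fin k,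
            ⟪fderiv ℝ X (T w, Ψ' w, w.2) (0, Pi.single j 1, 0),
              w.1 - X (T w, Ψ' w, w.2)⟫ = 0 := by
  set us : ℝ × (Fin k → ℝ) × (Fin l → ℝ) := (τs, ψ's, ψ''s)
  let z : (EuclideanSpace ℝ (Fin (k + l + 1)) × (Fin l → ℝ)) × (ℝ × (Fin k → ℝ)) →L[ℝ]
      ℝ × (Fin k → ℝ) × (Fin l → ℝ) :=
    (ContinuousLinearMap.fst ℝ _ _ ∘L ContinuousLinearMap.snd ℝ _ _).prod
      ((ContinuousLinearMap.snd ℝ _ _ ∘L ContinuousLinearMap.snd ℝ _ _).prod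
        (ContinuousLinearMap.snd ℝ _ _ ∘L ContinuousLinearMap.fst ℝ _ _))
  let B := fun q : (EuclideanSpace ℝ (Fin (k + l + 1)) × (Fin l → ℝ)) × (ℝ × (Fin k → ℝ)) =>
    q.1.1 - X (z q)
  let A := fun (j : Fin k)
    (q : (EuclideanSpace ℝ (Fin (k + l + 1)) × (Fin l → ℝ)) × (ℝ × (Fin k → ℝ))) =>
    fderiv ℝ X (z q) (0, Pi.single j 1, 0)
  let f := fun q => ((⟪P (z q), B q⟫ : ℝ), fun j : Fin k => (⟪A j q, B q⟫ : ℝ))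
  let S := z ⁻¹' U
  let u0 : (EuclideanSpace ℝ (Fin (k + l + 1)) × (Fin l → ℝ)) × (ℝ × (Fin k → ℝ)) :=
    ((X us, ψ''s), (τs, ψ's))
  have hS : IsOpen S := hU.preimage z.continuous
  have hu0 : u0 ∈ S := hbase
  have hz : ContDiffOn ℝ (⊤ : ℕ∞) z S := z.contDiff.contDiffOn
  have hPz : ContDiffOn ℝ (⊤ : ℕ∞) (fun q => P (z q)) S := hP.comp hz fun _ h => h
  have hB : ContDiffOn ℝ (⊤ : ℕ∞) B S :=
    (contDiff_fst.comp contDiff_fst).contDiffOn.sub (hX.comp hz fun _ h => h)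
  have hA : ∀ j, ContDiffOn ℝ (⊤ : ℕ∞) (A j) S := fun j =>
    ((hX.fderiv_of_isOpen hU (by simp)).comp hz fun _ h => h).clm_apply contDiffOn_const
  have hf1 : ContDiffOn ℝ (⊤ : ℕ∞) (fun q => (⟪P (z q), B q⟫ : ℝ)) S := hPz.inner ℝ hB
  have hf2 : ∀ j, ContDiffOn ℝ (⊤ : ℕ∞) (fun q => (⟪A j q, B q⟫ : ℝ)) S :=
    fun j => (hA j).inner ℝ hB
  have hf : ContDiffOn ℝ (⊤ : ℕ∞) f S := hf1.prodMk (contDiffOn_pi.2 hf2)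
  have hdiff : ∀ {H : Type} [NormedAddCommGroup H] [NormedSpace ℝ H]
      {g : (EuclideanSpace ℝ (Fin (k + l + 1)) × (Fin l → ℝ)) × (ℝ × (Fin k → ℝ)) → H},
      ContDiffOn ℝ (⊤ : ℕ∞) g S → DifferentiableAt ℝ g u0 := fun h =>
    (h.contDiffAt (hS.mem_nhds hu0)).differentiableAt (by simp)
  have hBu : B u0 = 0 := sub_self _
  have hB' : ∀ v : ℝ × (Fin k → ℝ),
      fderiv ℝ B u0 (0, v) = - fderiv ℝ X us (v.1, v.2, 0) := by
    intro v
    have hXd : HasFDerivAt X (fderiv ℝ X us) (z u0) :=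
      ((hX.contDiffAt (hU.mem_nhds hbase)).differentiableAt (by simp)).hasFDerivAt
    have h : HasFDerivAt B (ContinuousLinearMap.fst ℝ _ _ ∘L ContinuousLinearMap.fst ℝ _ _ -
        fderiv ℝ X us ∘L z) u0 :=
      (hasFDerivAt_fst.comp u0 hasFDerivAt_fst).sub (hXd.comp u0 z.hasFDerivAt)
    rw [h.fderiv]
    simp [z]
  have hsum : ∀ v : ℝ × (Fin k → ℝ), fderiv ℝ X us (v.1, v.2, 0) =
      v.1 • fderiv ℝ X us (1, 0, 0) +
        ∑ j, v.2 j • fderiv ℝ X us (0, Pi.single j 1, 0) := by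
    intro v
    simp only [← map_smul, ← map_sum, ← map_add]
    congr 1
    have h : ∑ j, v.2 j • ((0, Pi.single j 1, 0) : ℝ × (Fin k → ℝ) × (Fin l → ℝ)) =
        (0, v.2, 0) := by
      ext i <;> simp [Prod.fst_sum, Prod.snd_sum, Finset.sum_apply, Pi.single_apply]
    rw [h]
    simp
  have hinv : (fderiv ℝ f u0 ∘L .inr ℝ _ _).IsInvertible := by
    refine ContinuousLinearMap.isInvertible_of_injective fun v hv => ?_
    have hfd : fderiv ℝ f u0 = (fderiv ℝ (fun q => (⟪P (z q), B q⟫ : ℝ)) u0).prod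
        (ContinuousLinearMap.pi fun j => fderiv ℝ (fun q => (⟪A j q, B q⟫ : ℝ)) u0) :=
      ((hdiff hf1).hasFDerivAt.prodMk
        (hasFDerivAt_pi.2 fun j => (hdiff (hf2 j)).hasFDerivAt)).fderiv
    have hv' : fderiv ℝ f u0 (0, v) = 0 := by simpa using hv
    rw [hfd] at hv'
    have h1 : fderiv ℝ (fun q => (⟪P (z q), B q⟫ : ℝ)) u0 (0, v) = 0 := congrArg Prod.fst hv'
    have h2 : ∀ j, fderiv ℝ (fun q => (⟪A j q, B q⟫ : ℝ)) u0 (0, v) = 0 := fun j =>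
      congrFun (congrArg Prod.snd hv') j
    rw [fderiv_inner_apply_of_eq_zero (hdiff hPz) (hdiff hB) hBu, hB', inner_neg_right,
      neg_eq_zero, hsum, inner_add_right, inner_sum] at h1
    have hzu : z u0 = us := rfl
    simp only [inner_smul_right, hzu, heik1 us hbase, heik2 us hbase, mul_one, mul_zero,
      Finset.sum_const_zero, add_zero] at h1
    have h3 : ∀ j, (⟪fderiv ℝ X us (0, Pi.single j 1, 0),
        ∑ i, v.2 i • fderiv ℝ X us (0, Pi.single i 1, 0)⟫ : ℝ) = 0 := by
      intro j
      have := h2 j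
      rwa [fderiv_inner_apply_of_eq_zero (hdiff (hA j)) (hdiff hB) hBu, hB', inner_neg_right,
        neg_eq_zero, hsum, h1, zero_smul, zero_add] at this
    have h4 : ∑ i, v.2 i • fderiv ℝ X us (0, Pi.single i 1, 0) = 0 := by
      rw [← inner_self_eq_zero (𝕜 := ℝ), sum_inner]
      exact Finset.sum_eq_zero fun i _ => by rw [inner_smul_left, h3, mul_zero]
    exact Prod.ext h1 (funext (Fintype.linearIndependent_iff.1 hindep v.2 h4))
  obtain ⟨W, hWo, hW, g, hg, hgu, hgW⟩ := exists_contDiffOn_implicitFunction hS hf hu0 hinv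
  have hfu : f u0 = 0 := by
    simp only [f, hBu, inner_zero_right]
    rfl
  refine ⟨W, hWo, hW, fun w => (g w).1, fun w => (g w).2, contDiff_fst.comp_contDiffOn hg,
    contDiff_snd.comp_contDiffOn hg, congrArg Prod.fst hgu, congrArg Prod.snd hgu,
    fun w hw => ?_⟩
  obtain ⟨h1, h2⟩ := hgW w hw
  rw [hfu] at h2
  exact ⟨h1, congrArg Prod.fst h2, fun j => congrFun (congrArg Prod.snd h2) j⟩
end

section
/- Let A and B be real n×n matrices such that AᵀB = BᵀA and the 2n×n block matrix formed by stacking A on top of B has rank n. Then for every real ε > 0 the complex matrix A − iεB is invertible, i.e., det(A − iεB) ≠ 0. -/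
open Matrix

theorem Matrix.mulVec_injective_of_rank_eq_card {m n K : Type*} [Fintype m] [Fintype n] [Field K]
    {M : Matrix m n K} (h : M.rank = Fintype.card n) : Function.Injective M.mulVec := by
  have hker := M.mulVecLin.finrank_range_add_finrank_ker
  rw [← Matrix.rank, h, Module.finrank_fintype_fun_eq_card, Nat.add_eq_left,
    Submodule.finrank_eq_zero] at hker
  exact LinearMap.ker_eq_bot.mp hker

theorem Matrix.mulVec_map_ofReal {m n : Type*} [Fintype n] (A : Matrix m n ℝ) (v : n → ℂ)
    (i : m) : (A.map (fun a => (a : ℂ)) *ᵥ v) i =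
      ((A *ᵥ fun j => (v j).re) i : ℂ) + ((A *ᵥ fun j => (v j).im) i : ℂ) * Complex.I := by
  simp only [Matrix.mulVec, dotProduct, Matrix.map_apply, Complex.ofReal_sum, Finset.sum_mul,
    ← Finset.sum_add_distrib]
  refine Finset.sum_congr rfl fun j _ => ?_
  apply Complex.ext <;> simp

/-- For `Aᵀ * B = Bᵀ * A`, the real and imaginary parts `x`, `y` of a kernel vector of
`A - iεB` are annihilated by `B`. -/
theorem Matrix.mulVec_eq_zero_of_transpose_mul_comm {m n : Type*} [Fintype m] [Fintype n]
    {A B : Matrix m n ℝ} (hsym : Aᵀ * B = Bᵀ * A) {ε : ℝ} (hε : 0 < ε) {x y : n → ℝ}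
    (hx : A *ᵥ x = -(ε • B *ᵥ y)) (hy : A *ᵥ y = ε • B *ᵥ x) :
    B *ᵥ x = 0 ∧ B *ᵥ y = 0 := by
  have key : A *ᵥ x ⬝ᵥ B *ᵥ y = B *ᵥ x ⬝ᵥ A *ᵥ y := by
    have h := congrArg (fun M => x ⬝ᵥ M *ᵥ y) hsym
    simpa only [← Matrix.mulVec_mulVec, Matrix.dotProduct_mulVec x, Matrix.vecMul_transpose] using h
  rw [hx, hy, neg_dotProduct, smul_dotProduct, dotProduct_smul, smul_eq_mul, smul_eq_mul] at key
  have hxx : 0 ≤ B *ᵥ x ⬝ᵥ B *ᵥ x := Finset.sum_nonneg fun i _ => mul_self_nonneg _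
  have hyy : 0 ≤ B *ᵥ y ⬝ᵥ B *ᵥ y := Finset.sum_nonneg fun i _ => mul_self_nonneg _
  constructor <;> refine dotProduct_self_eq_zero.mp ?_ <;> nlinarith

/-- If `A` and `B` are real `n×n` matrices with `AᵀB = BᵀA` (the Lagrangian
condition) and the `2n×n` matrix obtained by stacking `A` on top of `B` has
rank `n` (the immersion condition), then for every `ε > 0` the complex matrix
`A − iεB` is invertible, i.e. `det(A − iεB) ≠ 0`. -/
theorem stmt3 (n : ℕ) (A B : Matrix (Fin n) (Fin n) ℝ)
    (hsym : Aᵀ * B = Bᵀ * A)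
    (hrank : (Matrix.fromRows A B).rank = n) :
    ∀ ε : ℝ, 0 < ε →
      (A.map (fun a => (a : ℂ)) - (Complex.I * (ε : ℂ)) • B.map (fun b => (b : ℂ))).det ≠ 0 := by
  intro ε hε hdet
  obtain ⟨v, hv, hker⟩ := Matrix.exists_mulVec_eq_zero_iff.mpr hdet
  have hinj := Matrix.mulVec_injective_of_rank_eq_card (hrank.trans (Fintype.card_fin n).symm)
  have hzero {w : Fin n → ℝ} (hA : A *ᵥ w = 0) (hB : B *ᵥ w = 0) : w = 0 := by
    refine hinj ?_
    ext (i | i) <;> simp [Matrix.fromRows_mulVec, hA, hB]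
  have hcomp i := congrFun hker i
  simp only [Matrix.sub_mulVec, Matrix.smul_mulVec, Pi.sub_apply, Pi.smul_apply,
    Matrix.mulVec_map_ofReal, Complex.ext_iff] at hcomp
  have hx : A *ᵥ (fun j => (v j).re) = -(ε • B *ᵥ fun j => (v j).im) := by
    ext i
    have := (hcomp i).1
    simp at this ⊢
    linarith
  have hy : A *ᵥ (fun j => (v j).im) = ε • B *ᵥ fun j => (v j).re := by
    ext i
    have := (hcomp i).2
    simp at this ⊢
    linarith
  obtain ⟨hBx, hBy⟩ := Matrix.mulVec_eq_zero_of_transpose_mul_comm hsym hε hx hy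
  have hre := hzero (by simpa [hBy] using hx) hBx
  have him := hzero (by simpa [hBx] using hy) hBy
  exact hv (funext fun j => Complex.ext (congrFun hre j) (congrFun him j))
end

section
/- Let V ⊆ ℝⁿ × ℝᵐ be open and Φ : V → ℝ be C², and let (x₀, θ₀) ∈ V satisfy ∇_θΦ(x₀, θ₀) = 0. If (η₁, ξ₁) and (η₂, ξ₂) in ℝⁿ × ℝᵐ both satisfy Φ_{θx}η_i + Φ_{θθ}ξ_i = 0 at (x₀, θ₀) (i.e., they are tangent to C_Φ), then ⟨Φ_{xx}η₁ + Φ_{xθ}ξ₁, η₂⟩ = ⟨Φ_{xx}η₂ + Φ_{xθ}ξ₂, η₁⟩. Equivalently, the standard symplectic form ω((x¹,p¹),(x²,p²)) = ⟨p¹, x²⟩ − ⟨p², x¹⟩ on ℝ^{2n} vanishes on the images (η_i, Φ_{xx}η_i + Φ_{xθ}ξ_i) of tangent vectors to C_Φ under the differential of j_Φ : (x,θ) ↦ (x, ∇_xΦ(x,θ)); hence Λ_Φ = j_Φ(C_Φ) is a Lagrangian submanifold. -/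
/-- A linear functional on `ℝⁿ` is the pairing with its coefficients on the standard basis. -/
theorem LinearMap.apply_eq_sum_mul_apply_single {n : ℕ} (f : (Fin n → ℝ) →ₗ[ℝ] ℝ)
    (x : Fin n → ℝ) : f x = ∑ i : Fin n, f (Pi.single i 1) * x i := by
  conv_lhs => rw [pi_eq_sum_univ' x, map_sum]
  refine Finset.sum_congr rfl fun i _ => ?_
  rw [map_smul, smul_eq_mul, mul_comm]

/-- A linear functional on `ℝⁿ × ℝᵐ` that vanishes on the second factor is determined by its
coefficients along the first factor. -/
theorem ContinuousLinearMap.apply_eq_sum_of_apply_inr_eq_zero {n m : ℕ}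
    (L : (Fin n → ℝ) × (Fin m → ℝ) →L[ℝ] ℝ)
    (hL : ∀ j : Fin m, L (0, Pi.single j 1) = 0) (η : Fin n → ℝ) (ξ : Fin m → ℝ) :
    L (η, ξ) = ∑ i : Fin n, L (Pi.single i 1, 0) * η i := by
  have hη := (L.toLinearMap ∘ₗ .inl ℝ (Fin n → ℝ) (Fin m → ℝ)).apply_eq_sum_mul_apply_single η
  have hξ := (L.toLinearMap ∘ₗ .inr ℝ (Fin n → ℝ) (Fin m → ℝ)).apply_eq_sum_mul_apply_single ξ
  simp only [LinearMap.comp_apply, LinearMap.inl_apply, LinearMap.inr_apply,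
    ContinuousLinearMap.coe_coe, hL, zero_mul, Finset.sum_const_zero] at hη hξ
  calc L (η, ξ) = L (η, 0) + L (0, ξ) := by rw [← map_add]; simp
    _ = ∑ i : Fin n, L (Pi.single i 1, 0) * η i := by rw [hη, hξ, add_zero]


/-- For a `C²` phase function `Φ(x,θ)` with `∇_θΦ(x₀,θ₀) = 0`: if `(η₁,ξ₁)`
and `(η₂,ξ₂)` are tangent to `C_Φ` (i.e. `Φ_{θx}η_i + Φ_{θθ}ξ_i = 0`), then
`⟨Φ_{xx}η₁ + Φ_{xθ}ξ₁, η₂⟩ = ⟨Φ_{xx}η₂ + Φ_{xθ}ξ₂, η₁⟩`; i.e. the symplectic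
form vanishes on the images of tangent vectors to `C_Φ` under the differential
of `j_Φ : (x,θ) ↦ (x, ∇_xΦ)`, so `Λ_Φ` is Lagrangian. -/
theorem stmt5 (n m : ℕ) (V : Set ((Fin n → ℝ) × (Fin m → ℝ))) (hV : IsOpen V)
    (Φ : (Fin n → ℝ) × (Fin m → ℝ) → ℝ) (hΦ : ContDiffOn ℝ 2 Φ V)
    (p₀ : (Fin n → ℝ) × (Fin m → ℝ)) (hp₀ : p₀ ∈ V)
    (hcrit : ∀ ζ : Fin m → ℝ, fderiv ℝ Φ p₀ (0, ζ) = 0)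
    (η₁ η₂ : Fin n → ℝ) (ξ₁ ξ₂ : Fin m → ℝ)
    (htan₁ : ∀ j : Fin m, fderiv ℝ (fderiv ℝ Φ) p₀ (η₁, ξ₁) (0, Pi.single j 1) = 0)
    (htan₂ : ∀ j : Fin m, fderiv ℝ (fderiv ℝ Φ) p₀ (η₂, ξ₂) (0, Pi.single j 1) = 0) :
    ∑ i : Fin n, fderiv ℝ (fderiv ℝ Φ) p₀ (η₁, ξ₁) (Pi.single i 1, 0) * η₂ i =
      ∑ i : Fin n, fderiv ℝ (fderiv ℝ Φ) p₀ (η₂, ξ₂) (Pi.single i 1, 0) * η₁ i := by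
  have hsymm : IsSymmSndFDerivAt ℝ Φ p₀ :=
    (hΦ.contDiffAt (hV.mem_nhds hp₀)).isSymmSndFDerivAt (by simp)
  rw [← ContinuousLinearMap.apply_eq_sum_of_apply_inr_eq_zero _ htan₁ η₂ ξ₂,
    ← ContinuousLinearMap.apply_eq_sum_of_apply_inr_eq_zero _ htan₂ η₁ ξ₁]
  exact hsymm.eq _ _
end

section
/- Let V ⊆ ℝⁿ × ℝᵐ be open and Φ : V → ℝ be a smooth nondegenerate phase function, i.e., the differentials of ∂Φ/∂θ₁, …, ∂Φ/∂θ_m are linearly independent at every point of C_Φ = {(x,θ) ∈ V : ∇_θΦ(x,θ) = 0}. Let a : V → ℂ be smooth with compact support contained in V, and suppose a vanishes identically on C_Φ. Then there exist smooth functions a₁, …, a_m : V → ℂ with compact support contained in V such that a(x,θ) = Σ_{j=1}^m a_j(x,θ) (∂Φ/∂θ_j)(x,θ) for all (x,θ) ∈ V. -/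
open Set Filter Topology
open scoped ContDiff Manifold

universe u

theorem hasFDerivAt_intervalIntegral_of_contDiff {E F : Type*} [NormedAddCommGroup E]
    [NormedSpace ℝ E] [FiniteDimensional ℝ E] [NormedAddCommGroup F] [NormedSpace ℝ F]
    (a b : ℝ) {f : E × ℝ → F} (hf : ContDiff ℝ 1 f) (x₀ : E) :
    HasFDerivAt (fun x => ∫ t in a..b, f (x, t))
      (∫ t in a..b, (fderiv ℝ f (x₀, t)).comp (ContinuousLinearMap.inl ℝ E ℝ)) x₀ := by
  have hf' : Continuous fun p : E × ℝ =>
      (fderiv ℝ f p).comp (ContinuousLinearMap.inl ℝ E ℝ) :=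
    (hf.continuous_fderiv one_ne_zero).clm_comp continuous_const
  obtain ⟨C, hC⟩ := ((isCompact_closedBall x₀ 1).prod isCompact_uIcc).exists_bound_of_continuousOn
    (s := Metric.closedBall x₀ 1 ×ˢ uIcc a b) hf'.continuousOn
  refine intervalIntegral.hasFDerivAt_integral_of_dominated_of_fderiv_le
    (F' := fun x t => (fderiv ℝ f (x, t)).comp (ContinuousLinearMap.inl ℝ E ℝ))
    (bound := fun _ => C) (Metric.closedBall_mem_nhds x₀ one_pos) ?_ ?_ ?_ ?_ ?_ ?_
  · exact .of_forall fun x => (hf.continuous.comp (by fun_prop)).aestronglyMeasurable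
  · exact (hf.continuous.comp (by fun_prop)).intervalIntegrable _ _
  · exact (hf'.comp (by fun_prop : Continuous fun t : ℝ => (x₀, t))).aestronglyMeasurable
  · exact .of_forall fun t ht x hx => hC (x, t) ⟨hx, uIoc_subset_uIcc ht⟩
  · exact intervalIntegrable_const
  · refine .of_forall fun t _ x _ => ?_
    exact ((hf.differentiable one_ne_zero).differentiableAt.hasFDerivAt (x := (x, t))).comp x
      (hasFDerivAt_prodMk_left x t)

theorem contDiff_intervalIntegral {E F : Type u} [NormedAddCommGroup E]
    [NormedSpace ℝ E] [FiniteDimensional ℝ E] [NormedAddCommGroup F] [NormedSpace ℝ F]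
    (a b : ℝ) {f : E × ℝ → F} (hf : ContDiff ℝ ∞ f) :
    ContDiff ℝ ∞ fun x => ∫ t in a..b, f (x, t) := by
  refine contDiff_infty.2 fun n => ?_
  induction n generalizing F with
  | zero =>
    exact contDiff_zero.2 (intervalIntegral.continuous_parametric_intervalIntegral_of_continuous'
      (f := fun x t => f (x, t)) hf.continuous a b)
  | succ n ih =>
    refine contDiff_succ_iff_hasFDerivAt.2 ⟨_, ih (f := fun p : E × ℝ =>
      (fderiv ℝ f p).comp (ContinuousLinearMap.inl ℝ E ℝ)) ?_,
      hasFDerivAt_intervalIntegral_of_contDiff a b (hf.of_le (by simp))⟩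
    exact (contDiff_infty_iff_fderiv.1 hf).2.clm_comp contDiff_const

/-- **Hadamard's lemma** with parameters. -/
theorem exists_contDiff_apply_eq_of_forall_zero {Y Z F : Type u} [NormedAddCommGroup Y]
    [NormedSpace ℝ Y] [FiniteDimensional ℝ Y] [NormedAddCommGroup Z] [NormedSpace ℝ Z]
    [FiniteDimensional ℝ Z] [NormedAddCommGroup F] [NormedSpace ℝ F] [CompleteSpace F]
    {h : Y × Z → F} (hh : ContDiff ℝ ∞ h) (h0 : ∀ z, h (0, z) = 0) :
    ∃ G : Y × Z → (Y →L[ℝ] F), ContDiff ℝ ∞ G ∧ ∀ w, h w = G w w.1 := by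
  have hcd : ContDiff ℝ ∞ fun p : (Y × Z) × ℝ =>
      (fderiv ℝ h (p.2 • p.1.1, p.1.2)).comp (ContinuousLinearMap.inl ℝ Y Z) :=
    ((contDiff_infty_iff_fderiv.1 hh).2.comp (by fun_prop)).clm_comp contDiff_const
  refine ⟨_, contDiff_intervalIntegral 0 1 hcd, fun w => ?_⟩
  have hcont : Continuous fun t : ℝ =>
      (fderiv ℝ h (t • w.1, w.2)).comp (ContinuousLinearMap.inl ℝ Y Z) :=
    hcd.continuous.comp (by fun_prop : Continuous fun t : ℝ => (w, t))
  rw [ContinuousLinearMap.intervalIntegral_apply (hcont.intervalIntegrable _ _)]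
  have hderiv (t : ℝ) : HasDerivAt (fun t : ℝ => h (t • w.1, w.2))
      ((fderiv ℝ h (t • w.1, w.2)).comp (ContinuousLinearMap.inl ℝ Y Z) w.1) t := by
    have h1 : HasDerivAt (fun t : ℝ => (t • w.1, w.2)) ((1 : ℝ) • w.1, (0 : Z)) t :=
      ((hasDerivAt_id t).smul_const w.1).prodMk (hasDerivAt_const t w.2)
    have h2 := (hh.differentiable (by simp)).differentiableAt.hasFDerivAt (x := (t • w.1, w.2))
    simpa [Function.comp_def] using h2.comp_hasDerivAt t h1
  rw [intervalIntegral.integral_eq_sub_of_hasDerivAt (fun t _ => hderiv t)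
    ((hcont.clm_apply continuous_const).intervalIntegrable _ _)]
  simp [h0]

/-- A smooth function vanishing on the zero set of a map `f` is, near a zero of `f` at which `f` is
a submersion, obtained by applying a smooth family of linear maps to `f`. -/
theorem exists_contDiffOn_apply_eq_of_eq_zero {E Y F : Type u} [NormedAddCommGroup E]
    [NormedSpace ℝ E] [FiniteDimensional ℝ E] [NormedAddCommGroup Y] [NormedSpace ℝ Y]
    [FiniteDimensional ℝ Y] [NormedAddCommGroup F] [NormedSpace ℝ F] [CompleteSpace F]
    {V : Set E} (hV : IsOpen V) {f : E → Y} (hf : ContDiffOn ℝ ∞ f V) {a : E → F}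
    (ha : ContDiff ℝ ∞ a) (hvan : ∀ x ∈ V, f x = 0 → a x = 0) {p : E} (hp : p ∈ V)
    (hsurj : (fderiv ℝ f p).range = ⊤) :
    ∃ U ∈ 𝓝 p, ∃ g : E → (Y →L[ℝ] F), ContDiffOn ℝ ∞ g U ∧ ∀ x ∈ U, g x (f x) = a x := by
  obtain ⟨R, hR⟩ := (fderiv ℝ f p).ker_closedComplemented_of_finiteDimensional_range
  let K := (fderiv ℝ f p).ker
  let Ψ : E → Y × K := fun x => (f x, R x)
  have hΨ : ContDiffOn ℝ ∞ Ψ V := hf.prodMk R.contDiff.contDiffOn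
  have hΨat {x : E} (hx : x ∈ V) : ContDiffAt ℝ ∞ Ψ x := hΨ.contDiffAt (hV.mem_nhds hx)
  let L : E ≃L[ℝ] Y × K := ContinuousLinearMap.equivProdOfSurjectiveOfIsCompl (fderiv ℝ f p) R
    hsurj (LinearMap.range_eq_of_proj hR) (LinearMap.isCompl_of_proj hR)
  have hL : HasFDerivAt Ψ (L : E →L[ℝ] Y × K) p :=
    ((hf.contDiffAt (hV.mem_nhds hp)).differentiableAt (by simp)).hasFDerivAt.prodMk R.hasFDerivAt
  let e := (hΨat hp).toOpenPartialHomeomorph Ψ hL (by simp)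
  have hpe : p ∈ e.source := (hΨat hp).mem_toOpenPartialHomeomorph_source hL (by simp)
  have he (x : E) : e x = Ψ x := rfl
  have hinv : ∀ᶠ x in 𝓝 p, x ∈ V ∧ fderiv ℝ Ψ x ∈ range ((↑) : (E ≃L[ℝ] Y × K) → _) := by
    have hc : ContinuousAt (fderiv ℝ Ψ) p :=
      ((hΨ.continuousOn_fderiv_of_isOpen hV (by simp)).continuousAt (hV.mem_nhds hp))
    refine (hV.eventually_mem hp).and (hc ?_)
    rw [hL.fderiv]
    exact L.nhds
  have hW : ∀ᶠ w in 𝓝 (Ψ p), w ∈ e.target ∧ e.symm w ∈ V ∧ ContDiffAt ℝ ∞ e.symm w := by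
    have h1 : ∀ᶠ w in 𝓝 (Ψ p), w ∈ e.target := e.open_target.mem_nhds (e.map_source hpe)
    have h2 : Tendsto e.symm (𝓝 (Ψ p)) (𝓝 p) := e.tendsto_symm hpe
    filter_upwards [h1, h2.eventually hinv] with w hw ⟨hwV, M, hM⟩
    refine ⟨hw, hwV, e.contDiffAt_symm hw (f₀' := M) ?_ (hΨat hwV)⟩
    rw [hM]
    exact ((hΨat hwV).differentiableAt (by simp)).hasFDerivAt
  obtain ⟨ε, hε, hball⟩ := Metric.nhds_basis_closedBall.mem_iff.1 hW
  let χ : ContDiffBump (Ψ p) := ⟨ε / 2, ε, by positivity, by linarith⟩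
  have hh : ContDiff ℝ ∞ fun w => χ w • a (e.symm w) := by
    refine contDiff_iff_contDiffAt.2 fun w => ?_
    by_cases hw : w ∈ Metric.closedBall (Ψ p) ε
    · exact χ.contDiffAt.smul (ha.contDiffAt.comp w (hball hw).2.2)
    · have : (fun w => χ w • a (e.symm w)) =ᶠ[𝓝 w] fun _ => 0 := by
        filter_upwards [Metric.isClosed_closedBall.isOpen_compl.mem_nhds hw] with v hv
        rw [χ.zero_of_le_dist, zero_smul]
        exact (not_le.1 (Metric.mem_closedBall.not.1 hv)).le
      exact contDiffAt_const.congr_of_eventuallyEq this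
  obtain ⟨G, hG, hhG⟩ := exists_contDiff_apply_eq_of_forall_zero hh fun z => by
    by_cases hw : ((0 : Y), z) ∈ Metric.closedBall (Ψ p) ε
    · obtain ⟨h1, h2, -⟩ := hball hw
      rw [hvan _ h2, smul_zero]
      exact congrArg Prod.fst (e.right_inv h1)
    · rw [χ.zero_of_le_dist, zero_smul]
      exact (not_le.1 (Metric.mem_closedBall.not.1 hw)).le
  have hU : ∀ᶠ x in 𝓝 p, x ∈ e.source ∧ x ∈ V ∧ Ψ x ∈ Metric.closedBall (Ψ p) (ε / 2) :=
    (e.open_source.eventually_mem hpe).and ((hV.eventually_mem hp).and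
      ((hΨat hp).continuousAt (Metric.closedBall_mem_nhds _ (half_pos hε))))
  refine ⟨_, hU, G ∘ Ψ, hG.comp_contDiffOn (hΨ.mono fun x hx => hx.2.1), fun x hx => ?_⟩
  have := hhG (Ψ x)
  rw [χ.one_of_mem_closedBall hx.2.2, one_smul, ← he, e.left_inv hx.1] at this
  exact this.symm

/-- Division by a smooth map `f` which is a submersion at each of its zeros. -/
theorem exists_contDiff_apply_eq_of_tsupport_subset {E Y F : Type u} [NormedAddCommGroup E]
    [NormedSpace ℝ E] [FiniteDimensional ℝ E] [NormedAddCommGroup Y] [NormedSpace ℝ Y]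
    [FiniteDimensional ℝ Y] [NormedAddCommGroup F] [NormedSpace ℝ F] [CompleteSpace F]
    {V : Set E} (hV : IsOpen V) {f : E → Y} (hf : ContDiffOn ℝ ∞ f V) {a : E → F}
    (ha : ContDiff ℝ ∞ a) (hvan : ∀ x ∈ V, f x = 0 → a x = 0) (hsupp : tsupport a ⊆ V)
    (hsurj : ∀ x ∈ V, f x = 0 → (fderiv ℝ f x).range = ⊤) :
    ∃ g : E → (Y →L[ℝ] F), ContDiff ℝ ∞ g ∧ ∀ x, g x (f x) = a x := by
  suffices hloc : ∀ p, ∃ U ∈ 𝓝 p, ∃ g : E → (Y →L[ℝ] F),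
      ContDiffOn ℝ ∞ g U ∧ ∀ x ∈ U, g x (f x) = a x by
    obtain ⟨g, hg⟩ := exists_contMDiffMap_forall_mem_convex_of_local (n := ⊤) 𝓘(ℝ, E)
      (t := fun x => {v : Y →L[ℝ] F | v (f x) = a x}) (fun x v hv w hw s t _ _ hst => by
        simp only [mem_ofPred_eq] at hv hw
        simp [hv, hw, ← add_smul, hst])
      (by simpa only [contMDiffOn_iff_contDiffOn, mem_ofPred_eq] using hloc)
    exact ⟨g, g.contMDiff.contDiff, hg⟩
  intro p
  by_cases hpa : p ∈ tsupport a
  · have hp := hsupp hpa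
    by_cases hfp : f p = 0
    · exact exists_contDiffOn_apply_eq_of_eq_zero hV hf ha hvan hp (hsurj p hp hfp)
    · obtain ⟨l, hl⟩ := SeparatingDual.exists_ne_zero (R := ℝ) hfp
      have hlf : ContDiffOn ℝ ∞ (fun x => l (f x)) V := l.contDiff.comp_contDiffOn hf
      have hU : ∀ᶠ x in 𝓝 p, x ∈ V ∧ l (f x) ≠ 0 :=
        (hV.eventually_mem hp).and
          ((hlf.continuousOn.continuousAt (hV.mem_nhds hp)).eventually_ne hl)
      refine ⟨_, hU, fun x => l.smulRight ((l (f x))⁻¹ • a x), ?_, fun x hx => ?_⟩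
      · exact contDiffOn_const.smulRight
          (((hlf.mono fun x hx => hx.1).inv fun x hx => hx.2).smul ha.contDiffOn)
      · simp [smul_smul, mul_inv_cancel₀ hx.2]
  · refine ⟨(tsupport a)ᶜ, (isClosed_tsupport a).isOpen_compl.mem_nhds hpa, 0,
      contDiffOn_const, fun x hx => ?_⟩
    simp [image_eq_zero_of_notMem_tsupport hx]

theorem range_pi_eq_top_of_linearIndependent {ι E : Type*} [Fintype ι] [NormedAddCommGroup E]
    [NormedSpace ℝ E] {l : ι → E →L[ℝ] ℝ} (hl : LinearIndependent ℝ l) :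
    (ContinuousLinearMap.pi l).range = ⊤ := by
  classical
  by_contra h
  obtain ⟨c, hc, hle⟩ := Submodule.exists_le_ker_of_lt_top _ (lt_top_iff_ne_top.2 h)
  refine hc ((Pi.basisFun ℝ ι).ext fun i => ?_)
  have := Fintype.linearIndependent_iff.1 hl (fun i => c (Pi.single i 1)) ?_ i
  · simpa using this
  ext x
  have hx : c (ContinuousLinearMap.pi l x) = 0 := hle ⟨x, rfl⟩
  rw [pi_eq_sum_univ' (ContinuousLinearMap.pi l x), map_sum] at hx
  simpa [mul_comm, ← Pi.single_apply] using hx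

/-- Division by the derivatives of a nondegenerate phase function: if `Φ` is
smooth on the open set `V ⊆ ℝⁿ × ℝᵐ` and the differentials of
`∂Φ/∂θ₁, …, ∂Φ/∂θ_m` are linearly independent at every point of
`C_Φ = {∇_θΦ = 0}`, then every smooth compactly supported `a` with
`supp a ⊆ V` vanishing on `C_Φ` can be written as
`a = Σ_j a_j ∂Φ/∂θ_j` with smooth `a_j` compactly supported in `V`. -/
theorem stmt8 (n m : ℕ) (V : Set ((Fin n → ℝ) × (Fin m → ℝ))) (hV : IsOpen V)
    (Φ : (Fin n → ℝ) × (Fin m → ℝ) → ℝ) (hΦ : ContDiffOn ℝ (⊤ : ℕ∞) Φ V)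
    (hnondeg : ∀ p ∈ V, (∀ j : Fin m, fderiv ℝ Φ p (0, Pi.single j 1) = 0) →
      LinearIndependent ℝ
        (fun j : Fin m => fderiv ℝ (fun q => fderiv ℝ Φ q (0, Pi.single j 1)) p))
    (a : (Fin n → ℝ) × (Fin m → ℝ) → ℂ) (ha : ContDiff ℝ (⊤ : ℕ∞) a)
    (hcpt : HasCompactSupport a) (hsupp : tsupport a ⊆ V)
    (hvan : ∀ p ∈ V, (∀ j : Fin m, fderiv ℝ Φ p (0, Pi.single j 1) = 0) → a p = 0) :
    ∃ b : Fin m → ((Fin n → ℝ) × (Fin m → ℝ) → ℂ),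
      (∀ j, ContDiff ℝ (⊤ : ℕ∞) (b j) ∧ HasCompactSupport (b j) ∧ tsupport (b j) ⊆ V) ∧
      ∀ p ∈ V, a p = ∑ j, b j p * ((fderiv ℝ Φ p (0, Pi.single j 1) : ℝ) : ℂ) := by
  have hD : ContDiffOn ℝ ∞ (fderiv ℝ Φ) V := hΦ.fderiv_of_isOpen hV (by simp)
  let f : (Fin n → ℝ) × (Fin m → ℝ) → Fin m → ℝ := fun p j => fderiv ℝ Φ p (0, Pi.single j 1)
  have hf : ContDiffOn ℝ ∞ f V := contDiffOn_pi.2 fun j => hD.clm_apply contDiffOn_const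
  obtain ⟨g, hg, hga⟩ := exists_contDiff_apply_eq_of_tsupport_subset hV hf ha
    (fun x hx h => hvan x hx (congrFun h)) hsupp fun x hx h => by
      have hfx : fderiv ℝ f x = ContinuousLinearMap.pi fun j => fderiv ℝ (fun q => f q j) x :=
        fderiv_pi fun j => ((contDiffOn_pi.1 hf j).contDiffAt (hV.mem_nhds hx)).differentiableAt
          (by simp)
      rw [hfx]
      exact range_pi_eq_top_of_linearIndependent (hnondeg x hx (congrFun h))
  obtain ⟨K, hK, haK, hKV⟩ := exists_compact_between hcpt hV hsupp
  obtain ⟨χ, hχ1, hχ0, -⟩ := exists_contMDiffMap_one_nhds_of_subset_interior (n := ⊤)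
    𝓘(ℝ, (Fin n → ℝ) × (Fin m → ℝ)) (isClosed_tsupport a) haK
  have hb (j : Fin m) : tsupport (fun x => χ x • g x (Pi.single j 1)) ⊆ K := by
    refine closure_minimal (fun x hx => ?_) hK.isClosed
    by_contra hxK
    exact hx (by simp [hχ0 x hxK])
  refine ⟨fun j x => χ x • g x (Pi.single j 1), fun j => ⟨?_, ?_, (hb j).trans hKV⟩,
    fun p _ => ?_⟩
  · exact χ.contMDiff.contDiff.smul (hg.clm_apply contDiff_const)
  · exact hK.of_isClosed_subset (isClosed_tsupport _) (hb j)
  have hχa : a p = χ p • a p := by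
    by_cases hp : p ∈ tsupport a
    · rw [hχ1.self_of_nhdsSet p hp, one_smul]
    · simp [image_eq_zero_of_notMem_tsupport hp]
  rw [hχa, ← hga p, pi_eq_sum_univ' (f p), map_sum, Finset.smul_sum]
  refine Finset.sum_congr rfl fun j _ => ?_
  simp [f, mul_comm, mul_left_comm]
end

section
/- Let λ : ℝ → ℝ be a smooth positive function and k ∈ ℝ. Define n(ψ) = (cos ψ, sin ψ) ∈ ℝ² and the maps X₀(α, ψ, φ) = (α n(ψ), φ) ∈ ℝ³ and P₀(α, ψ, φ) = (λ(φ) n(ψ), α λ'(φ) + k) ∈ ℝ³. Then for every (α, ψ, φ) ∈ ℝ³ and every tangent vector (η_α, η_ψ, η_φ) ∈ ℝ³, ⟨P₀(α,ψ,φ), DX₀(α,ψ,φ)(η_α, η_ψ, η_φ)⟩ = λ(φ) η_α + (α λ'(φ) + k) η_φ, which equals the derivative of the function S(α, ψ, φ) = λ(φ) α + k φ in the direction (η_α, η_ψ, η_φ). That is, the pullback of the 1-form ⟨p, dx⟩ under (X₀, P₀) equals d(λ(φ)α + kφ), so τ = λ(φ)α + kφ is an eikonal on the Lagrangian manifold parametrized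 by (X₀, P₀). -/
/-- The standard inner product on `ℝ × ℝ × ℝ`. -/
def dot3 (u v : ℝ × ℝ × ℝ) : ℝ := u.1 * v.1 + u.2.1 * v.2.1 + u.2.2 * v.2.2

/-- For the Bessel-beam Lagrangian manifold parametrized by
`X₀(α,ψ,φ) = (α n(ψ), φ)`, `P₀(α,ψ,φ) = (λ(φ) n(ψ), αλ'(φ) + k)` with
`n(ψ) = (cos ψ, sin ψ)`, the pullback of `⟨p, dx⟩` is
`λ(φ) dα + (αλ'(φ) + k) dφ = d(λ(φ)α + kφ)`; i.e. for every point `q = (α,ψ,φ)`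
and tangent vector `v = (η_α, η_ψ, η_φ)`,
`⟨P₀(q), DX₀(q)v⟩ = λ(φ)η_α + (αλ'(φ)+k)η_φ = dS(q)v` where `S = λ(φ)α + kφ`.
Hence `τ = λ(φ)α + kφ` is an eikonal. -/
theorem stmt13 (l : ℝ → ℝ) (hl : ContDiff ℝ (⊤ : ℕ∞) l) (hlpos : ∀ s, 0 < l s) (k : ℝ)
    (X₀ : ℝ × ℝ × ℝ → ℝ × ℝ × ℝ)
    (hX₀ : X₀ = fun q => (q.1 * Real.cos q.2.1, q.1 * Real.sin q.2.1, q.2.2))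
    (P₀ : ℝ × ℝ × ℝ → ℝ × ℝ × ℝ)
    (hP₀ : P₀ = fun q =>
      (l q.2.2 * Real.cos q.2.1, l q.2.2 * Real.sin q.2.1, q.1 * deriv l q.2.2 + k))
    (S : ℝ × ℝ × ℝ → ℝ) (hS : S = fun q => l q.2.2 * q.1 + k * q.2.2) :
    ∀ q v : ℝ × ℝ × ℝ,
      dot3 (P₀ q) (fderiv ℝ X₀ q v) = l q.2.2 * v.1 + (q.1 * deriv l q.2.2 + k) * v.2.2 ∧
      l q.2.2 * v.1 + (q.1 * deriv l q.2.2 + k) * v.2.2 = fderiv ℝ S q v := by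
  intro q v
  have hα : HasFDerivAt (fun q : ℝ × ℝ × ℝ => q.1) (ContinuousLinearMap.fst ℝ ℝ (ℝ × ℝ)) q :=
    hasFDerivAt_fst
  have hψ : HasFDerivAt (fun q : ℝ × ℝ × ℝ => q.2.1)
      ((ContinuousLinearMap.fst ℝ ℝ ℝ).comp (ContinuousLinearMap.snd ℝ ℝ (ℝ × ℝ))) q :=
    hasFDerivAt_fst.comp q hasFDerivAt_snd
  have hφ : HasFDerivAt (fun q : ℝ × ℝ × ℝ => q.2.2)
      ((ContinuousLinearMap.snd ℝ ℝ ℝ).comp (ContinuousLinearMap.snd ℝ ℝ (ℝ × ℝ))) q :=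
    hasFDerivAt_snd.comp q hasFDerivAt_snd
  have hlφ := ((hl.differentiable (by simp)) q.2.2).hasDerivAt.comp_hasFDerivAt q hφ
  have hX := (hα.mul hψ.cos).prodMk ((hα.mul hψ.sin).prodMk hφ)
  have hdS := (hlφ.mul hα).add (hφ.const_mul k)
  subst hX₀ hP₀ hS
  refine ⟨(congrArg (fun L => dot3 _ (L v)) hX.fderiv).trans ?_,
    Eq.trans ?_ (congrArg (fun L => L v) hdS.fderiv).symm⟩
  · simp [dot3]
    linear_combination (l q.2.2 * v.1) * Real.sin_sq_add_cos_sq q.2.1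
  · simp
    ring
end
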